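/- arXiv:2002.11541 — 6 statements merged into one kernel-verified Lean document; each statement's English description precedes it below -/
import Mathlib

section
/- Let G be a finite directed acyclic graph in which every vertex has out-degree at most d, where d ≥ 1. For every vertex v of G there exists a vertex w reachable from v (by a directed path, possibly of length 0) such that ⌈|D(v)|/(3d)⌉ ≤ |D(w)| ≤ ⌈|D(v)|/3⌉, where for a vertex x, D(x) denotes the set of vertices reachable from x by a directed path (including x itself). -/
/-- For a directed graph given by an edge relation `E`, `descSet E v` is the set of
vertices reachable from `v` by a directed path (possibly of length 0), so `v ∈ descSet E v`. -/
def descSet {V : Type*} (E : V → V → Prop) (v : V) : Set V :=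
  {u | Relation.ReflTransGen E v u}

/-- The descendants of `w` are `w` itself and the descendants of its out-neighbours. -/
theorem ncard_descSet_le_succ_mul {V : Type*} [Finite V] (E : V → V → Prop) {d m : ℕ} {w : V}
    (hdeg : Nat.card {y : V | E w y} ≤ d) (hm : ∀ y, E w y → (descSet E y).ncard ≤ m) :
    (descSet E w).ncard ≤ d * m + 1 := by
  classical
  have := Fintype.ofFinite V
  have hsub : descSet E w ⊆
      ↑(insert w ((Finset.univ.filter (E w)).biUnion fun y => (descSet E y).toFinset)) := by
    intro u hu
    rcases Relation.ReflTransGen.cases_head hu with rfl | ⟨y, hwy, hyu⟩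
    · simp
    · simp only [Finset.coe_insert, Set.mem_insert_iff, Finset.mem_coe, Finset.mem_biUnion,
        Finset.mem_filter, Finset.mem_univ, true_and, Set.mem_toFinset]
      exact Or.inr ⟨y, hwy, hyu⟩
  have hcard : (Finset.univ.filter (E w)).card ≤ d := by
    simpa [Nat.card_eq_fintype_card, Fintype.card_subtype] using hdeg
  calc (descSet E w).ncard
      ≤ _ := Set.ncard_le_ncard hsub (Finset.finite_toSet _)
    _ = _ := Set.ncard_coe_finset _
    _ ≤ _ := Finset.card_insert_le _ _
    _ ≤ (Finset.univ.filter (E w)).card * m + 1 := by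
        gcongr
        refine Finset.card_biUnion_le_card_mul _ _ _ fun y hy => ?_
        rw [← Set.ncard_eq_toFinset_card']
        exact hm y (by simpa using hy)
    _ ≤ d * m + 1 := by gcongr

/-- In a finite acyclic digraph, passing to an out-neighbour strictly shrinks the descendant
set. -/
theorem ncard_descSet_lt {V : Type*} [Finite V] {E : V → V → Prop}
    (hacyclic : ∀ x : V, ¬ Relation.TransGen E x x) {w y : V} (hwy : E w y) :
    (descSet E y).ncard < (descSet E w).ncard := by
  refine Set.ncard_lt_ncard ⟨fun u hu => Relation.ReflTransGen.head hwy hu, fun hsub => ?_⟩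
    (Set.toFinite _)
  exact hacyclic w (Relation.TransGen.head' hwy (hsub Relation.ReflTransGen.refl))

/-- Structure lemma: in a finite DAG with all out-degrees at most `d ≥ 1`, every vertex `v`
has a descendant `w` with `⌈|D(v)|/(3d)⌉ ≤ |D(w)| ≤ ⌈|D(v)|/3⌉`. -/
theorem exists_splittable_vertex {V : Type*} [Fintype V] (E : V → V → Prop) (d : ℕ)
    (hd : 1 ≤ d)
    (hacyclic : ∀ x : V, ¬ Relation.TransGen E x x)
    (hdeg : ∀ x : V, Nat.card {y : V | E x y} ≤ d)
    (v : V) :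
    ∃ w : V, Relation.ReflTransGen E v w ∧
      Nat.card (descSet E v) ⌈/⌉ (3 * d) ≤ Nat.card (descSet E w) ∧
      Nat.card (descSet E w) ≤ Nat.card (descSet E v) ⌈/⌉ 3 := by
  simp only [Nat.card_coe_set_eq]
  set n := (descSet E v).ncard
  have hpos : 0 < n :=
    (Set.ncard_pos (Set.toFinite _)).2 ⟨v, Relation.ReflTransGen.refl⟩
  have hn3 : n ≤ 3 * (n ⌈/⌉ 3) := (ceilDiv_le_iff_le_mul (by omega)).1 le_rfl
  by_cases hv : n ≤ n ⌈/⌉ 3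
  · refine ⟨v, Relation.ReflTransGen.refl, ?_, hv⟩
    rw [ceilDiv_le_iff_le_mul (by omega)]
    nlinarith
  obtain ⟨w, ⟨hvw, hw⟩, hmin⟩ := Set.exists_min_image
    {w | Relation.ReflTransGen E v w ∧ n ⌈/⌉ 3 < (descSet E w).ncard}
    (fun w => (descSet E w).ncard) (Set.toFinite _)
    ⟨v, Relation.ReflTransGen.refl, not_le.1 hv⟩
  by_contra! hcon
  have hchild : ∀ y, E w y → (descSet E y).ncard ≤ n ⌈/⌉ (3 * d) - 1 := by
    intro y hwy
    have hvy := hvw.tail hwy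
    by_contra! hlt
    exact (ncard_descSet_lt hacyclic hwy).not_ge
      (hmin y ⟨hvy, hcon y hvy (by omega)⟩)
  have hle := ncard_descSet_le_succ_mul E (hdeg w) hchild
  have hceil : 0 < n ⌈/⌉ (3 * d) := by
    by_contra! h
    have := (ceilDiv_le_iff_le_mul (by omega)).1 h
    omega
  have hlt : 3 * d * (n ⌈/⌉ (3 * d) - 1) < n := by
    by_contra! h
    have := (ceilDiv_le_iff_le_mul (by omega)).2 h
    omega
  rw [mul_assoc] at hlt
  omega
end

section
/- Let G = (V,E) be a finite directed graph and let ℓ, m ∈ V be distinct vertices that are both sinks of G (no outgoing edges), such that there is no directed path from ℓ to m in G, and such that every vertex u ∉ {ℓ} that has a directed path to ℓ in G also has a directed path to m in G. Let G' = (V, E ∪ {(ℓ,m)}). Then for every ordered pair (u,w) ∈ V × V with (u,w) ≠ (ℓ,m), there is a directed path from u to w in G' if and only if there is one in G; and for the pair (ℓ,m), G' has a directed path from ℓ to m while G does not. In particular, adding the edge (ℓ,m) changes the answer of exactly one path query. -/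
/-- Lower bound core lemma: if `l ≠ m` are sinks of a finite directed graph `G`, `l` does not
reach `m`, and every vertex other than `l` that reaches `l` also reaches `m`, then adding the
edge `(l,m)` changes the answer of exactly one path query, namely `(l,m)`. -/
theorem add_edge_changes_one_query {V : Type*} [Fintype V] (E : V → V → Prop)
    (l m : V) (hlm : l ≠ m)
    (hl : ∀ x : V, ¬ E l x) (hm : ∀ x : V, ¬ E m x)
    (hnr : ¬ Relation.ReflTransGen E l m)
    (hcov : ∀ u : V, u ≠ l → Relation.ReflTransGen E u l → Relation.ReflTransGen E u m) :
    (∀ u w : V, (u, w) ≠ (l, m) →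
      (Relation.ReflTransGen (fun a b => E a b ∨ (a = l ∧ b = m)) u w ↔
        Relation.ReflTransGen E u w)) ∧
    Relation.ReflTransGen (fun a b => E a b ∨ (a = l ∧ b = m)) l m ∧
    ¬ Relation.ReflTransGen E l m := by
  have key : ∀ u w : V, Relation.ReflTransGen (fun a b => E a b ∨ (a = l ∧ b = m)) u w →
      Relation.ReflTransGen E u w ∨ (u = l ∧ w = m) := by
    intro u w h
    induction h with
    | refl => exact Or.inl .refl
    | @tail b c _ hbc ih =>
      rcases ih with ih | ⟨rfl, rfl⟩
      · rcases hbc with hbc | ⟨rfl, rfl⟩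
        · exact Or.inl (ih.tail hbc)
        · by_cases hu : u = b
          · exact Or.inr ⟨hu, rfl⟩
          · exact Or.inl (hcov u hu ih)
      · rcases hbc with hbc | ⟨h, _⟩
        · exact absurd hbc (hm _)
        · exact absurd h.symm hlm
  refine ⟨fun u w huw => ⟨fun h => (key u w h).resolve_right ?_,
      fun h => Relation.ReflTransGen.mono (fun _ _ => Or.inl) _ _ h⟩,
    .single (Or.inr ⟨rfl, rfl⟩), hnr⟩
  rintro ⟨rfl, rfl⟩
  exact huw rfl
end

section
/- Let n be an even number with n ≥ 6, and let C be the caterpillar graph on the vertex set {v_1, ..., v_{n-1}} with edges v_k → v_{k+1} for 1 ≤ k ≤ n/2 − 1 and v_k → v_{n/2+k} for 1 ≤ k ≤ n/2 − 1. For indices 1 ≤ i < j ≤ n/2 − 1, let G_{ij} be the graph obtained from C by adding the edge (v_{n/2+i}, v_{n/2+j}). Then for every ordered pair of vertices (u,w) with (u,w) ≠ (v_{n/2+i}, v_{n/2+j}), there is a directed path from u to w in G_{ij} if and only if there is one in C, while G_{ij} has a directed path from v_{n/2+i} to v_{n/2+j} and C does not. That is, the presence of the added edge changes the answer of exactly the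 single path query (v_{n/2+i}, v_{n/2+j}). -/
/-- The caterpillar graph on vertices `v_1, …, v_{n-1}` (identified with the natural numbers
`1, …, n-1`): spine edges `v_k → v_{k+1}` and leg edges `v_k → v_{n/2+k}` for
`1 ≤ k ≤ n/2 - 1`. -/
def caterpillarEdge (n : ℕ) (a b : ℕ) : Prop :=
  (1 ≤ a ∧ a ≤ n / 2 - 1 ∧ b = a + 1) ∨ (1 ≤ a ∧ a ≤ n / 2 - 1 ∧ b = n / 2 + a)

theorem caterpillarEdge.le_half {n a b : ℕ} (h : caterpillarEdge n a b) : a ≤ n / 2 - 1 := by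
  rcases h with h | h <;> exact h.2.1

theorem caterpillarEdge.eq_of_leaf {n a k : ℕ} (hk : 1 ≤ k)
    (h : caterpillarEdge n a (n / 2 + k)) : a = k := by
  rcases h with h | h <;> omega

theorem caterpillar_reach_spine {n a b : ℕ} (ha : 1 ≤ a) (hab : a ≤ b) (hb : b ≤ n / 2) :
    Relation.ReflTransGen (caterpillarEdge n) a b := by
  induction b, hab using Nat.le_induction with
  | base => exact .refl
  | succ b hab ih => exact (ih (by omega)).tail (Or.inl ⟨by omega, by omega, rfl⟩)

/-- Every non-leaf ancestor of a leaf is also an ancestor of all later leaves. -/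
theorem caterpillar_reach_later_leaf {n i j u : ℕ} (hi : 1 ≤ i) (hij : i ≤ j)
    (hj : j ≤ n / 2 - 1)
    (h : Relation.ReflTransGen (caterpillarEdge n) u (n / 2 + i)) :
    u = n / 2 + i ∨ Relation.ReflTransGen (caterpillarEdge n) u (n / 2 + j) := by
  rcases h.cases_tail with h | ⟨b, hub, hb⟩
  · exact Or.inl h.symm
  · obtain rfl := hb.eq_of_leaf hi
    exact Or.inr ((hub.trans (caterpillar_reach_spine hi hij (by omega))).tail
      (Or.inr ⟨by omega, hj, rfl⟩))

theorem caterpillar_reach_of_reach_add_edge {n i j u w : ℕ} (hi : 1 ≤ i) (hij : i < j)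
    (hj : j ≤ n / 2 - 1)
    (h : Relation.ReflTransGen
      (fun a b => caterpillarEdge n a b ∨ (a = n / 2 + i ∧ b = n / 2 + j)) u w) :
    Relation.ReflTransGen (caterpillarEdge n) u w ∨ (u = n / 2 + i ∧ w = n / 2 + j) := by
  induction h with
  | refl => exact Or.inl .refl
  | tail _ hbc ih =>
    rcases ih with hub | ⟨-, rfl⟩
    · rcases hbc with hbc | ⟨rfl, rfl⟩
      · exact Or.inl (hub.tail hbc)
      · exact (caterpillar_reach_later_leaf hi hij.le hj hub).symm.imp_right fun h => ⟨h, rfl⟩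
    · rcases hbc with hbc | ⟨hb, -⟩
      · have := hbc.le_half
        omega
      · omega

/-- Adding the edge `(v_{n/2+i}, v_{n/2+j})` (for `1 ≤ i < j ≤ n/2 - 1`) to the caterpillar
graph changes the answer of exactly the single path query `(v_{n/2+i}, v_{n/2+j})`. -/
theorem caterpillar_single_query (n : ℕ) (hn : Even n) (h6 : 6 ≤ n) (i j : ℕ)
    (hi : 1 ≤ i) (hij : i < j) (hj : j ≤ n / 2 - 1) :
    (∀ u w : ℕ, 1 ≤ u → u ≤ n - 1 → 1 ≤ w → w ≤ n - 1 →
      (u, w) ≠ (n / 2 + i, n / 2 + j) →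
      (Relation.ReflTransGen
          (fun a b => caterpillarEdge n a b ∨ (a = n / 2 + i ∧ b = n / 2 + j)) u w ↔
        Relation.ReflTransGen (caterpillarEdge n) u w)) ∧
    Relation.ReflTransGen
      (fun a b => caterpillarEdge n a b ∨ (a = n / 2 + i ∧ b = n / 2 + j))
      (n / 2 + i) (n / 2 + j) ∧
    ¬ Relation.ReflTransGen (caterpillarEdge n) (n / 2 + i) (n / 2 + j) := by
  refine ⟨fun u w _ _ _ _ hne => ⟨fun h => ?_,
      fun h => Relation.ReflTransGen.mono (fun _ _ => Or.inl) _ _ h⟩,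
    .single (Or.inr ⟨rfl, rfl⟩), fun h => ?_⟩
  · refine (caterpillar_reach_of_reach_add_edge hi hij hj h).resolve_right ?_
    rintro ⟨rfl, rfl⟩
    exact hne rfl
  · rcases h.cases_head with h | ⟨b, hb, -⟩
    · omega
    · have := hb.le_half
      omega
end

section
/- Let n be an even number with n ≥ 6, and let C be the caterpillar graph on the vertex set {v_1, ..., v_{n-1}} with edges v_k → v_{k+1} for 1 ≤ k ≤ n/2 − 1 and v_k → v_{n/2+k} for 1 ≤ k ≤ n/2 − 1. For 1 ≤ i < j ≤ n/2 − 1 let G_{ij} be C with the additional edge (v_{n/2+i}, v_{n/2+j}). Then for distinct index pairs (i,j) ≠ (i',j') with i < j and i' < j', the reachability relations of G_{ij} and G_{i'j'} are different; in fact they differ exactly on the two ordered pairs (v_{n/2+i}, v_{n/2+j}) and (v_{n/2+i'}, v_{n/2+j'}). -/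
/-- Along the spine, every vertex reaches all later spine vertices. -/
theorem reflTransGen_caterpillarEdge_spine {n u w : ℕ} (hu : 1 ≤ u) (huw : u ≤ w)
    (hw : w ≤ n / 2) : Relation.ReflTransGen (caterpillarEdge n) u w := by
  induction w, huw using Nat.le_induction with
  | base => exact .refl
  | succ w huw ih =>
    exact (ih (by omega)).tail (Or.inl ⟨by omega, by omega, rfl⟩)

/-- Reachability in the caterpillar with one extra edge from leg `i` to a later leg `j`. -/
theorem reflTransGen_caterpillarEdge_or_iff {n i j : ℕ} (hi : 1 ≤ i) (hij : i < j)
    (hj : j ≤ n / 2 - 1) (u w : ℕ) :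
    Relation.ReflTransGen
        (fun a b => caterpillarEdge n a b ∨ (a = n / 2 + i ∧ b = n / 2 + j)) u w ↔
      u = w ∨ (1 ≤ u ∧ u ≤ w ∧ w ≤ n / 2) ∨
        (1 ≤ u ∧ n / 2 + u ≤ w ∧ w ≤ n / 2 + (n / 2 - 1)) ∨
        (u = n / 2 + i ∧ w = n / 2 + j) := by
  constructor
  · intro h
    induction h with
    | refl => exact Or.inl rfl
    | tail _ hbc ih =>
      unfold caterpillarEdge at hbc
      omega
  · rintro (rfl | ⟨hu, huw, hw⟩ | ⟨hu, huw, hw⟩ | ⟨rfl, rfl⟩)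
    · exact .refl
    · exact Relation.ReflTransGen.mono (fun _ _ => Or.inl) _ _
        (reflTransGen_caterpillarEdge_spine hu huw hw)
    · have hspine : Relation.ReflTransGen (caterpillarEdge n) u (w - n / 2) :=
        reflTransGen_caterpillarEdge_spine hu (by omega) (by omega)
      exact (Relation.ReflTransGen.mono (fun _ _ => Or.inl) _ _ hspine).tail
        (Or.inl (Or.inr ⟨by omega, by omega, by omega⟩))
    · exact .single (Or.inr ⟨rfl, rfl⟩)

/-- For distinct index pairs `(i,j) ≠ (i',j')` with `1 ≤ i < j ≤ n/2 - 1` and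
`1 ≤ i' < j' ≤ n/2 - 1`, the graphs obtained from the caterpillar by adding the edge
`(v_{n/2+i}, v_{n/2+j})`, resp. `(v_{n/2+i'}, v_{n/2+j'})`, have different reachability
relations; in fact they differ exactly on the two ordered pairs `(v_{n/2+i}, v_{n/2+j})`
and `(v_{n/2+i'}, v_{n/2+j'})`. -/
theorem caterpillar_candidates_distinct (n : ℕ) (hn : Even n) (h6 : 6 ≤ n)
    (i j i' j' : ℕ)
    (hi : 1 ≤ i) (hij : i < j) (hj : j ≤ n / 2 - 1)
    (hi' : 1 ≤ i') (hij' : i' < j') (hj' : j' ≤ n / 2 - 1)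
    (hne : (i, j) ≠ (i', j')) :
    (¬ ∀ u w : ℕ,
        Relation.ReflTransGen
          (fun a b => caterpillarEdge n a b ∨ (a = n / 2 + i ∧ b = n / 2 + j)) u w ↔
        Relation.ReflTransGen
          (fun a b => caterpillarEdge n a b ∨ (a = n / 2 + i' ∧ b = n / 2 + j')) u w) ∧
    (∀ u w : ℕ,
      (¬ (Relation.ReflTransGen
            (fun a b => caterpillarEdge n a b ∨ (a = n / 2 + i ∧ b = n / 2 + j)) u w ↔
          Relation.ReflTransGen
            (fun a b => caterpillarEdge n a b ∨ (a = n / 2 + i' ∧ b = n / 2 + j')) u w)) ↔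
        ((u, w) = (n / 2 + i, n / 2 + j) ∨ (u, w) = (n / 2 + i', n / 2 + j'))) := by
  have hdiff : ∀ u w : ℕ,
      (¬ (Relation.ReflTransGen
            (fun a b => caterpillarEdge n a b ∨ (a = n / 2 + i ∧ b = n / 2 + j)) u w ↔
          Relation.ReflTransGen
            (fun a b => caterpillarEdge n a b ∨ (a = n / 2 + i' ∧ b = n / 2 + j')) u w)) ↔
        ((u, w) = (n / 2 + i, n / 2 + j) ∨ (u, w) = (n / 2 + i', n / 2 + j')) := by
    intro u w
    rw [reflTransGen_caterpillarEdge_or_iff hi hij hj,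
      reflTransGen_caterpillarEdge_or_iff hi' hij' hj']
    simp only [ne_eq, Prod.mk.injEq] at hne ⊢
    omega
  exact ⟨fun h => (hdiff _ _).2 (Or.inl rfl) (h _ _), hdiff⟩
end

section
/- Let T = (V,E) be a rooted directed tree with root r, let c1, c2 ∈ V be such that neither is reachable from the other in T (no directed path from c1 to c2 and none from c2 to c1), and let G = (V, E ∪ {(c1,c2)}). Then there exist vertices v, a, b ∈ V such that: (v,a) ∈ E; b is a leaf of T (a vertex with no outgoing edges); there is a directed path from v to b in T; there is no directed path from a to b in T; and there is a directed path from a to b in G. (Such a vertex v is called a top vertex; one may take v to be the lowest common ancestor of c1 and c2 in T, a the child of v on the tree path to c1, and b any leaf of T reachable from c2 in T.) -/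
/-- `IsRootedDirTree E r` says that the directed graph with edge relation `E` is a rooted
directed tree with root `r`: every vertex is reachable from `r`, the root has no incoming
edge, every non-root vertex has a unique parent, and there are no directed cycles. -/
def IsRootedDirTree {V : Type*} (E : V → V → Prop) (r : V) : Prop :=
  (∀ v : V, Relation.ReflTransGen E r v) ∧
  (∀ u : V, ¬ E u r) ∧
  (∀ v : V, v ≠ r → ∃! u : V, E u v) ∧
  (∀ v : V, ¬ Relation.TransGen E v v)

namespace IsRootedDirTree

variable {V : Type*} {E : V → V → Prop} {r : V}

theorem parent_unique (hT : IsRootedDirTree E r) {u v w : V} (hu : E u w) (hv : E v w) :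
    u = v := by
  refine (hT.2.2.1 w ?_).unique hu hv
  rintro rfl
  exact hT.2.1 u hu

theorem comparable_of_common_descendant (hT : IsRootedDirTree E r) {x y b : V}
    (hx : Relation.ReflTransGen E x b) (hy : Relation.ReflTransGen E y b) :
    Relation.ReflTransGen E x y ∨ Relation.ReflTransGen E y x := by
  have hU : Relator.RightUnique (Function.swap E) := fun _ _ _ hu hv => hT.parent_unique hu hv
  exact (Relation.ReflTransGen.total_of_right_unique hU hx.swap hy.swap).symm.imp
    Relation.reflTransGen_swap.1 Relation.reflTransGen_swap.1

theorem exists_leaf [Finite V] (hT : IsRootedDirTree E r) (x : V) :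
    ∃ b, Relation.ReflTransGen E x b ∧ ∀ y, ¬ E b y := by
  let R : V → V → Prop := fun u v => Relation.TransGen E v u
  have : IsTrans V R := ⟨fun _ _ _ h h' => Relation.TransGen.trans h' h⟩
  have : Std.Irrefl R := ⟨hT.2.2.2⟩
  obtain ⟨b, hb, hmin⟩ := (Finite.wellFounded_of_trans_of_irrefl R).has_min
    {b | Relation.ReflTransGen E x b} ⟨x, Relation.ReflTransGen.refl⟩
  exact ⟨b, hb, fun y hy => hmin y (Relation.ReflTransGen.tail hb hy) (.single hy)⟩

end IsRootedDirTree

/-- A path from an ancestor of `y` to a vertex that does not reach `y` has an edge along which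
reachability of `y` is lost. -/
theorem Relation.ReflTransGen.exists_last_ancestor {V : Type*} {E : V → V → Prop} {x y z : V}
    (hxz : Relation.ReflTransGen E x z) (hxy : Relation.ReflTransGen E x y)
    (hzy : ¬ Relation.ReflTransGen E z y) :
    ∃ v a, E v a ∧ Relation.ReflTransGen E v y ∧ Relation.ReflTransGen E a z ∧
      ¬ Relation.ReflTransGen E a y := by
  induction hxz using Relation.ReflTransGen.head_induction_on with
  | refl => exact absurd hxy hzy
  | @head x w hxw hwz ih =>
    by_cases hwy : Relation.ReflTransGen E w y
    · exact ih hwy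
    · exact ⟨x, w, hxw, hxy, hwz, hwy⟩

/-- Existence of a top-vertex triple: if `G` is obtained from a rooted directed tree `T` by
adding an edge `(c1,c2)` between two incomparable vertices, then there are vertices `v`, `a`,
`b` with `(v,a)` a tree edge, `b` a leaf of `T`, `b` a tree-descendant of `v`, `b` not a
tree-descendant of `a`, yet `a` reaches `b` in `G`. -/
theorem exists_top_vertex {V : Type*} [Fintype V] (E : V → V → Prop) (r : V)
    (hT : IsRootedDirTree E r) (c1 c2 : V)
    (h12 : ¬ Relation.ReflTransGen E c1 c2)
    (h21 : ¬ Relation.ReflTransGen E c2 c1) :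
    ∃ v a b : V, E v a ∧ (∀ x : V, ¬ E b x) ∧
      Relation.ReflTransGen E v b ∧
      ¬ Relation.ReflTransGen E a b ∧
      Relation.ReflTransGen (fun x y => E x y ∨ (x = c1 ∧ y = c2)) a b := by
  obtain ⟨v, a, hva, hv, ha, hac2⟩ := (hT.1 c1).exists_last_ancestor (hT.1 c2) h12
  obtain ⟨b, hb, hleaf⟩ := hT.exists_leaf c2
  refine ⟨v, a, b, hva, hleaf, hv.trans hb, fun hab => ?_, ?_⟩
  · rcases hT.comparable_of_common_descendant hab hb with h | h
    · exact hac2 h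
    · exact h21 (h.trans ha)
  · have hle : E ≤ fun x y => E x y ∨ (x = c1 ∧ y = c2) := fun _ _ => Or.inl
    exact ((Relation.ReflTransGen.mono hle _ _ ha).tail (Or.inr ⟨rfl, rfl⟩)).trans
      (Relation.ReflTransGen.mono hle _ _ hb)
end

section
/- Let T = (V,E) be a rooted directed tree with root r, let c1, c2 ∈ V be such that neither is reachable from the other in T, and let G = (V, E ∪ {(c1,c2)}). Suppose v, a, b ∈ V satisfy: (v,a) ∈ E; there is no directed path from a to b in T; and there is a directed path from a to b in G. Then there is a directed path from a to c1 in T and a directed path from c2 to b in T. (Thus, once a top-vertex triple (v,a,b) is found, the cross edge (c1,c2) is localized: its tail is a descendant of a and its head is an ancestor of b in the tree.) -/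
/-- A walk in a relation augmented by the single edge `(c1, c2)` either survives in the original
relation, or its endpoints reach the tail and are reached from the head of that edge. -/
theorem Relation.ReflTransGen.of_add_edge {V : Type*} {E : V → V → Prop} {c1 c2 a b : V}
    (h : Relation.ReflTransGen (fun x y => E x y ∨ (x = c1 ∧ y = c2)) a b) :
    Relation.ReflTransGen E a b ∨
      (Relation.ReflTransGen E a c1 ∧ Relation.ReflTransGen E c2 b) := by
  induction h with
  | refl => exact .inl .refl
  | tail _ hstep ih =>
    rcases hstep with hE | ⟨rfl, rfl⟩
    · exact ih.imp (·.tail hE) (·.imp_right (·.tail hE))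
    · exact .inr ⟨ih.elim id And.left, .refl⟩

/-- Localization of the cross edge: if `G` is a rooted directed tree `T` plus one edge
`(c1,c2)` between incomparable vertices, and `(v,a,b)` is a triple with `(v,a)` a tree edge,
`a` not reaching `b` in `T` but reaching `b` in `G`, then `a` reaches `c1` in `T` and `c2`
reaches `b` in `T`. -/
theorem cross_edge_localized {V : Type*} [Fintype V] (E : V → V → Prop) (r : V)
    (hT : IsRootedDirTree E r) (c1 c2 : V)
    (h12 : ¬ Relation.ReflTransGen E c1 c2)
    (h21 : ¬ Relation.ReflTransGen E c2 c1)
    (v a b : V) (hva : E v a)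
    (hnab : ¬ Relation.ReflTransGen E a b)
    (hGab : Relation.ReflTransGen (fun x y => E x y ∨ (x = c1 ∧ y = c2)) a b) :
    Relation.ReflTransGen E a c1 ∧ Relation.ReflTransGen E c2 b :=
  hGab.of_add_edge.resolve_left hnab
end
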